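/- Let J be a finite index set, let γ : J → Finset J assign to each index a finite set of 'neighbor' indices, let ε : J → J → ℤ, and let M be a real vector space with a : J → M. Fix j ∈ J and assume that for every index m that belongs to γ(l) for some l ∈ γ(j), the set P(m) = {l ∈ γ(j) : m ∈ γ(l)} contains exactly two elements l₁ ≠ l₂, and that these satisfy ε(j, l₁) · ε(l₁, m) = − ε(j, l₂) · ε(l₂, m). Then the double sum ∑_{l ∈ γ(j)} ∑_{m ∈ γ(l)} (ε(j, l) · ε(l, m)) • a(m) equals 0 in M. -/

import Mathlib

/-- Sign cancellation in the double jump sum: if every second-level neighbor `m` of `j` is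
reached through exactly two intermediate indices `l₁ ≠ l₂`, whose orientation products are
opposite, then `∑_{l ∈ γ j} ∑_{m ∈ γ l} (ε j l · ε l m) • a m = 0`; this is the identity
behind `𝕕𝕕𝔞 = 0` for the discrete jump operator. -/
theorem jump_operator_squared_zero
    {J : Type*} [Fintype J] [DecidableEq J]
    (γ : J → Finset J) (ε : J → J → ℤ)
    {M : Type*} [AddCommGroup M] [Module ℝ M]
    (a : J → M) (j : J)
    (hpair : ∀ m : J, (∃ l ∈ γ j, m ∈ γ l) →
      ∃ l₁ l₂ : J, l₁ ≠ l₂ ∧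
        (γ j).filter (fun l => m ∈ γ l) = {l₁, l₂} ∧
        ε j l₁ * ε l₁ m = -(ε j l₂ * ε l₂ m)) :
    ∑ l ∈ γ j, ∑ m ∈ γ l, (ε j l * ε l m) • a m = 0 := by
  have hswap : ∑ l ∈ γ j, ∑ m ∈ γ l, (ε j l * ε l m) • a m =
      ∑ m, ∑ l ∈ γ j with m ∈ γ l, (ε j l * ε l m) • a m :=
    Finset.sum_comm' (by simp)
  rw [hswap]
  refine Finset.sum_eq_zero fun m _ => ?_
  by_cases hm : ∃ l ∈ γ j, m ∈ γ l
  · obtain ⟨l₁, l₂, hne, hfilter, hsign⟩ := hpair m hm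
    rw [hfilter, Finset.sum_pair hne, hsign, neg_smul, neg_add_cancel]
  · rw [Finset.filter_eq_empty_iff.mpr fun l hl hml => hm ⟨l, hl, hml⟩, Finset.sum_empty]
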